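/- arXiv:2203.06221 — 8 statements merged into one kernel-verified Lean document; each statement's English description precedes it below -/
import Mathlib

section
/- For every n×n pairwise comparison matrix A, with κ = 1 − KI(A), the Manhattan distance between the eigenvalue priority vector w_EV and the geometric mean priority vector w_GM satisfies κ² − 1 ≤ MD(w_EV, w_GM) ≤ 1/κ² − 1. -/
/-- Two normalized positive vectors, each compatible with the reciprocal matrix `A` up to the factor
`κ`, are comparable entrywise up to the factor `κ ^ 2`. -/
lemma sq_mul_le_of_mul_le {ι : Type*} [Fintype ι] {A : Matrix ι ι ℝ} {κ : ℝ} {u v : ι → ℝ}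
    (hpos : ∀ i j, 0 < A i j) (hrec : ∀ i j, A j i = 1 / A i j) (hκ : 0 < κ)
    (hu : ∀ i, 0 < u i) (hv : ∀ i, 0 < v i) (hu1 : ∑ i, u i = 1) (hv1 : ∑ i, v i = 1)
    (hAu : ∀ i k, κ * A i k * u k ≤ u i) (hAv : ∀ i k, κ * A i k * v k ≤ v i) (i : ι) :
    κ ^ 2 * u i ≤ v i := by
  have key : ∀ k, κ ^ 2 * u i * v k ≤ v i * u k := fun k => by
    have h1 : κ * u i ≤ A i k * u k := by
      have h := mul_le_mul_of_nonneg_left (hAu k i) (hpos i k).le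
      have hA := (hpos i k).ne'
      rw [hrec i k] at h
      calc κ * u i = A i k * (κ * (1 / A i k) * u i) := by field_simp
        _ ≤ _ := h
    calc κ ^ 2 * u i * v k = κ * u i * (κ * v k) := by ring
      _ ≤ A i k * u k * (κ * v k) :=
        mul_le_mul_of_nonneg_right h1 (mul_pos hκ (hv k)).le
      _ = κ * A i k * v k * u k := by ring
      _ ≤ v i * u k := mul_le_mul_of_nonneg_right (hAv i k) (hu k).le
  simpa [← Finset.mul_sum, hu1, hv1] using Finset.sum_le_sum fun k (_ : k ∈ Finset.univ) => key k

/-- A positive eigenvector of `A` is compatible with `A` up to the factor `κ`. -/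
lemma mul_le_of_mulVec_eq_smul {ι : Type*} [Fintype ι] {A : Matrix ι ι ℝ} {κ lam : ℝ} {w : ι → ℝ}
    (hpos : ∀ i j, 0 < A i j) (hA : ∀ i j k, κ * A i k * A k j ≤ A i j)
    (hw : ∀ i, 0 < w i) (heig : A.mulVec w = lam • w) (i k : ι) :
    κ * A i k * w k ≤ w i := by
  have hrow : ∀ i, ∑ j, A i j * w j = lam * w i := fun i => by
    simpa [Matrix.mulVec, dotProduct] using congrFun heig i
  have hlam : 0 < lam := by
    have h : 0 < lam * w i := by
      rw [← hrow i]
      exact Finset.sum_pos (fun j _ => mul_pos (hpos i j) (hw j)) ⟨i, Finset.mem_univ i⟩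
    exact pos_of_mul_pos_left h (hw i).le
  refine le_of_mul_le_mul_left ?_ hlam
  calc lam * (κ * A i k * w k) = κ * A i k * ∑ j, A k j * w j := by rw [hrow]; ring
    _ = ∑ j, κ * A i k * A k j * w j := by
      rw [Finset.mul_sum]
      exact Finset.sum_congr rfl fun j _ => by ring
    _ ≤ ∑ j, A i j * w j :=
      Finset.sum_le_sum fun j _ => mul_le_mul_of_nonneg_right (hA i j k) (hw j).le
    _ = lam * w i := hrow i

/-- The vector of geometric means of the rows of `A` is compatible with `A` up to the factor `κ`. -/
lemma mul_rpow_prod_le {n : ℕ} (hn : n ≠ 0) {A : Matrix (Fin n) (Fin n) ℝ} {κ : ℝ}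
    (hpos : ∀ i j, 0 < A i j) (hκ : 0 < κ) (hA : ∀ i j k, κ * A i k * A k j ≤ A i j)
    (i k : Fin n) :
    κ * A i k * (∏ j, A k j) ^ ((n : ℝ)⁻¹) ≤ (∏ j, A i j) ^ ((n : ℝ)⁻¹) := by
  have hc : 0 < κ * A i k := mul_pos hκ (hpos i k)
  have hprod : (κ * A i k) ^ n * ∏ j, A k j ≤ ∏ j, A i j := by
    calc (κ * A i k) ^ n * ∏ j, A k j = ∏ j, κ * A i k * A k j := by
          simp [Finset.prod_mul_distrib, mul_pow]
      _ ≤ ∏ j, A i j :=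
        Finset.prod_le_prod (fun j _ => (mul_pos hc (hpos k j)).le) fun j _ => hA i j k
  have hP : 0 ≤ ∏ j, A k j := Finset.prod_nonneg fun j _ => (hpos k j).le
  calc κ * A i k * (∏ j, A k j) ^ ((n : ℝ)⁻¹)
      = ((κ * A i k) ^ n * ∏ j, A k j) ^ ((n : ℝ)⁻¹) := by
        rw [Real.mul_rpow (pow_nonneg hc.le n) hP, Real.pow_rpow_inv_natCast hc.le hn]
    _ ≤ _ := Real.rpow_le_rpow (mul_nonneg (pow_nonneg hc.le n) hP) hprod (by positivity)

/-- Kułakowski et al.: For every `n × n` pairwise comparison matrix `A`,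
with `κ = 1 - KI(A)` (where `KI` is Koczkodaj's inconsistency index), the Manhattan distance
between the eigenvalue priority vector `wEV` and the geometric mean priority vector `wGM`
satisfies `κ² - 1 ≤ MD(wEV, wGM) ≤ 1/κ² - 1`. -/
theorem stmt_0 (n : ℕ) (A : Matrix (Fin n) (Fin n) ℝ)
    (hpos : ∀ i j, 0 < A i j)
    (hrec : ∀ i j, A j i = 1 / A i j)
    -- Koczkodaj's inconsistency index `KI(A)`
    (KI : ℝ)
    (hKI : IsGreatest
      {x : ℝ | ∃ i j k : Fin n,
        x = 1 - min (A i j / (A i k * A k j)) ((A i k * A k j) / A i j)} KI)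
    -- the eigenvalue (EV) priority vector: positive, normalized, eigenvector of the
    -- largest (Perron) eigenvalue `lam`
    (wEV : Fin n → ℝ) (lam : ℝ)
    (hEVpos : ∀ i, 0 < wEV i)
    (hEVsum : ∑ i, wEV i = 1)
    (hEVeig : A.mulVec wEV = lam • wEV)
    (hlamMax : ∀ (μ : ℝ) (v : Fin n → ℝ), v ≠ 0 → A.mulVec v = μ • v → μ ≤ lam)
    -- the geometric mean (GM) priority vector
    (wGM : Fin n → ℝ)
    (hGM : ∀ i, wGM i =
      (∏ k, A i k) ^ ((n : ℝ)⁻¹) / ∑ j, (∏ k, A j k) ^ ((n : ℝ)⁻¹)) :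
    (1 - KI) ^ 2 - 1 ≤ ∑ i, |wEV i - wGM i| ∧
      ∑ i, |wEV i - wGM i| ≤ 1 / (1 - KI) ^ 2 - 1 := by
  obtain ⟨⟨i₀, j₀, k₀, hκ₀⟩, hub⟩ := hKI
  set κ := 1 - KI with hκdef
  have hn : n ≠ 0 := (Fin.pos i₀).ne'
  have hκ : 0 < κ := by
    have hκmin : κ = min (A i₀ j₀ / (A i₀ k₀ * A k₀ j₀)) (A i₀ k₀ * A k₀ j₀ / A i₀ j₀) := by
      linarith
    have hA := mul_pos (hpos i₀ k₀) (hpos k₀ j₀)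
    rw [hκmin]
    exact lt_min (div_pos (hpos _ _) hA) (div_pos hA (hpos _ _))
  have hκmin : ∀ i j k, κ ≤ min (A i j / (A i k * A k j)) (A i k * A k j / A i j) :=
    fun i j k => by linarith [hub ⟨i, j, k, rfl⟩]
  have hA : ∀ i j k, κ * A i k * A k j ≤ A i j := fun i j k => by
    rw [mul_assoc, ← le_div_iff₀ (mul_pos (hpos i k) (hpos k j))]
    exact (hκmin i j k).trans (min_le_left _ _)
  have hκ1 : κ ≤ 1 := by
    have hdiag : A i₀ i₀ * A i₀ i₀ = 1 := by
      nth_rewrite 1 [hrec i₀ i₀]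
      exact one_div_mul_cancel (hpos i₀ i₀).ne'
    have h := hA i₀ i₀ i₀
    have hone : A i₀ i₀ = 1 := by nlinarith [hpos i₀ i₀]
    simpa [hone] using h
  have hsq : κ ^ 2 ≤ 1 := pow_le_one₀ hκ.le hκ1
  have hgpos : ∀ i, 0 < (∏ k, A i k) ^ ((n : ℝ)⁻¹) := fun i =>
    Real.rpow_pos_of_pos (Finset.prod_pos fun k _ => hpos i k) _
  have hS : 0 < ∑ j, (∏ k, A j k) ^ ((n : ℝ)⁻¹) :=
    Finset.sum_pos (fun j _ => hgpos j) ⟨i₀, Finset.mem_univ i₀⟩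
  have hGMpos : ∀ i, 0 < wGM i := fun i => hGM i ▸ div_pos (hgpos i) hS
  have hGMsum : ∑ i, wGM i = 1 := by
    simp_rw [hGM, ← Finset.sum_div]
    exact div_self hS.ne'
  have hEVle := mul_le_of_mulVec_eq_smul hpos hA hEVpos hEVeig
  have hGMle : ∀ i k, κ * A i k * wGM k ≤ wGM i := fun i k => by
    rw [hGM, hGM, ← mul_div_assoc]
    exact div_le_div_of_nonneg_right (mul_rpow_prod_le hn hpos hκ hA i k) hS.le
  have hEVGM := sq_mul_le_of_mul_le hpos hrec hκ hEVpos hGMpos hEVsum hGMsum hEVle hGMle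
  have hGMEV := sq_mul_le_of_mul_le hpos hrec hκ hGMpos hEVpos hGMsum hEVsum hGMle hEVle
  refine ⟨(sub_nonpos.2 hsq).trans (Finset.sum_nonneg fun i _ => abs_nonneg _), ?_⟩
  have hterm : ∀ i, |wEV i - wGM i| ≤ (1 / κ ^ 2 - 1) * wGM i := fun i => by
    have hκ2 : 0 < κ ^ 2 := by positivity
    have hcancel : κ ^ 2 * (1 / κ ^ 2) = 1 := mul_one_div_cancel hκ2.ne'
    have hupper : wEV i ≤ 1 / κ ^ 2 * wGM i := by
      refine le_of_mul_le_mul_left ?_ hκ2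
      rw [← mul_assoc, hcancel, one_mul]
      exact hEVGM i
    have hlower : 2 ≤ 1 / κ ^ 2 + κ ^ 2 := by
      have h : 1 ≤ 1 / κ ^ 2 := (one_le_div hκ2).2 hsq
      nlinarith
    rw [abs_le]
    constructor <;> nlinarith [hGMEV i, hGMpos i]
  calc ∑ i, |wEV i - wGM i| ≤ ∑ i, (1 / κ ^ 2 - 1) * wGM i := Finset.sum_le_sum fun i _ => hterm i
    _ = 1 / κ ^ 2 - 1 := by rw [← Finset.mul_sum, hGMsum, mul_one]
end

section
/- Let A be an n×n pairwise comparison matrix, let w_EV and w_GM be the eigenvalue and geometric mean priority vectors, and suppose the objects are indexed so that w_EV is strictly decreasing: (w_EV)_1 > (w_EV)_2 > … > (w_EV)_n. Let d = min over i ∈ {1,…,n−1} of ((w_EV)_i − (w_EV)_{i+1}) and κ = 1 − KI(A). If d > 1/κ² − 1, then the ordinal rankings induced by w_EV and w_GM are identical; that is, for all i, j: (w_EV)_i > (w_EV)_j implies (w_GM)_i > (w_GM)_j. -/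
/-- If row `i` of a positive matrix is entrywise at most `c` times row `j`, the same holds for the
corresponding entries of a positive eigenvector. -/
theorem le_mul_of_eigenvector_of_row_le {ι : Type*} [Fintype ι] {A : Matrix ι ι ℝ}
    (hpos : ∀ i j, 0 < A i j) {w : ι → ℝ} {lam : ℝ} (hw : ∀ i, 0 < w i)
    (heig : A.mulVec w = lam • w) {i j : ι} {c : ℝ} (h : ∀ k, A i k ≤ c * A j k) :
    w i ≤ c * w j := by
  have heig' (l : ι) : ∑ k, A l k * w k = lam * w l := congrFun heig l
  have hlam : 0 < lam := by
    have hsum : 0 < ∑ k, A i k * w k :=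
      Finset.sum_pos (fun k _ => mul_pos (hpos i k) (hw k)) ⟨i, Finset.mem_univ i⟩
    rw [heig'] at hsum
    exact pos_of_mul_pos_left hsum (hw i).le
  have hle : ∑ k, A i k * w k ≤ c * ∑ k, A j k * w k := by
    rw [Finset.mul_sum]
    refine Finset.sum_le_sum fun k _ => ?_
    rw [← mul_assoc]
    exact mul_le_mul_of_nonneg_right (h k) (hw k).le
  rw [heig', heig'] at hle
  exact le_of_mul_le_mul_left (by linarith) hlam

/-- If row `i` of a positive matrix is entrywise larger than row `j`, so is its normalized
geometric mean. -/
theorem geom_mean_lt_of_row_lt {n : ℕ} {A : Matrix (Fin n) (Fin n) ℝ}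
    (hpos : ∀ i j, 0 < A i j) {i j : Fin n} (h : ∀ k, A j k < A i k) :
    (∏ k, A j k) ^ ((n : ℝ)⁻¹) / ∑ l, (∏ k, A l k) ^ ((n : ℝ)⁻¹) <
      (∏ k, A i k) ^ ((n : ℝ)⁻¹) / ∑ l, (∏ k, A l k) ^ ((n : ℝ)⁻¹) := by
  have hn : 0 < n := i.pos
  have hprod (l : Fin n) : 0 < ∏ k, A l k := Finset.prod_pos fun k _ => hpos l k
  refine div_lt_div_of_pos_right ?_
    (Finset.sum_pos (fun l _ => Real.rpow_pos_of_pos (hprod l) _) ⟨i, Finset.mem_univ i⟩)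
  refine Real.rpow_lt_rpow (hprod j).le ?_ (by positivity)
  exact Finset.prod_lt_prod_of_nonempty (fun k _ => hpos j k) (fun k _ => h k)
    ⟨i, Finset.mem_univ i⟩

/-- Proposition 1: Let `A` be an `n × n` pairwise comparison matrix with
eigenvalue priority vector `wEV` (strictly decreasing in the chosen indexing) and geometric
mean priority vector `wGM`. Let `d` be the minimum gap between adjacent entries of `wEV`
and `κ = 1 - KI(A)`. If `d > 1/κ² - 1`, then the ordinal rankings induced by `wEV` and
`wGM` are identical: `wEV i > wEV j → wGM i > wGM j`. -/
theorem stmt_1 (n : ℕ) (A : Matrix (Fin n) (Fin n) ℝ)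
    (hpos : ∀ i j, 0 < A i j)
    (hrec : ∀ i j, A j i = 1 / A i j)
    -- Koczkodaj's inconsistency index `KI(A)`
    (KI : ℝ)
    (hKI : IsGreatest
      {x : ℝ | ∃ i j k : Fin n,
        x = 1 - min (A i j / (A i k * A k j)) ((A i k * A k j) / A i j)} KI)
    -- the eigenvalue (EV) priority vector: positive, normalized, eigenvector of the
    -- largest (Perron) eigenvalue `lam`
    (wEV : Fin n → ℝ) (lam : ℝ)
    (hEVpos : ∀ i, 0 < wEV i)
    (hEVsum : ∑ i, wEV i = 1)
    (hEVeig : A.mulVec wEV = lam • wEV)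
    (hlamMax : ∀ (μ : ℝ) (v : Fin n → ℝ), v ≠ 0 → A.mulVec v = μ • v → μ ≤ lam)
    -- the indexing is such that `wEV` is strictly decreasing
    (hdec : ∀ i j : Fin n, i < j → wEV j < wEV i)
    -- the geometric mean (GM) priority vector
    (wGM : Fin n → ℝ)
    (hGM : ∀ i, wGM i =
      (∏ k, A i k) ^ ((n : ℝ)⁻¹) / ∑ j, (∏ k, A j k) ^ ((n : ℝ)⁻¹))
    -- `d` is the minimum gap between adjacent EV weights
    (d : ℝ)
    (hd : IsLeast
      {x : ℝ | ∃ i : Fin n, ∃ h : (i : ℕ) + 1 < n,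
        x = wEV i - wEV ⟨(i : ℕ) + 1, h⟩} d)
    -- the sufficient condition `d > 1/κ² - 1`
    (hcond : d > 1 / (1 - KI) ^ 2 - 1) :
    ∀ i j : Fin n, wEV i > wEV j → wGM i > wGM j := by
  intro i j hij
  obtain ⟨κ, rfl⟩ : ∃ κ, KI = 1 - κ := ⟨1 - KI, by ring⟩
  rw [sub_sub_cancel] at hcond
  have hκ : 0 < κ := by
    obtain ⟨a, b, c, h⟩ := hKI.1
    have : 0 < min (A a b / (A a c * A c b)) ((A a c * A c b) / A a b) :=
      lt_min (div_pos (hpos _ _) (mul_pos (hpos _ _) (hpos _ _)))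
        (div_pos (mul_pos (hpos _ _) (hpos _ _)) (hpos _ _))
    linarith
  have hmin (a b c : Fin n) :
      κ ≤ min (A a b / (A a c * A c b)) ((A a c * A c b) / A a b) := by
    have := hKI.2 ⟨a, b, c, rfl⟩
    linarith
  have hlower (a b c : Fin n) : κ * (A a c * A c b) ≤ A a b :=
    (le_div_iff₀ (mul_pos (hpos _ _) (hpos _ _))).1 ((hmin a b c).trans (min_le_left _ _))
  have hupper (a b c : Fin n) : κ * A a b ≤ A a c * A c b :=
    (le_div_iff₀ (hpos _ _)).1 ((hmin a b c).trans (min_le_right _ _))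
  have hdiag : A i i = 1 := by
    have h := hrec i i
    rw [eq_div_iff (hpos i i).ne'] at h
    nlinarith [hpos i i]
  have hκ_le : κ ≤ 1 := by
    have := hlower i i i
    rw [hdiag] at this
    linarith
  have hgap : d ≤ wEV i - wEV j := by
    have hlt : i < j := by
      by_contra hnot
      rcases (not_lt.1 hnot).lt_or_eq with h | h
      · exact (hdec j i h).not_gt hij
      · exact hij.ne (by rw [h])
    have hsucc : (i : ℕ) + 1 < n := lt_of_le_of_lt (Nat.succ_le_of_lt hlt) j.isLt
    have hle := hd.2 ⟨i, hsucc, rfl⟩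
    have hmono : wEV j ≤ wEV ⟨(i : ℕ) + 1, hsucc⟩ := by
      rcases (show (⟨(i : ℕ) + 1, hsucc⟩ : Fin n) ≤ j from Nat.succ_le_of_lt hlt).lt_or_eq
        with h | h
      · exact (hdec _ _ h).le
      · rw [h]
    linarith
  have hw_le : wEV j ≤ 1 :=
    hEVsum ▸ Finset.single_le_sum (fun k _ => (hEVpos k).le) (Finset.mem_univ j)
  have hratio : wEV j < κ ^ 2 * wEV i := by
    have hinv : 1 ≤ 1 / κ ^ 2 := one_le_one_div (by positivity) (pow_le_one₀ hκ.le hκ_le)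
    have hlt : 1 / κ ^ 2 * wEV j < wEV i := by
      nlinarith [mul_nonneg (sub_nonneg.2 hinv) (sub_nonneg.2 hw_le)]
    rw [one_div_mul_eq_div, div_lt_iff₀ (by positivity)] at hlt
    linarith
  have hEV : wEV i ≤ A i j / κ * wEV j := by
    refine le_mul_of_eigenvector_of_row_le hpos hEVpos hEVeig fun k => ?_
    rw [div_mul_eq_mul_div, le_div_iff₀ hκ]
    linarith [hupper i k j]
  have hscale : 1 < κ * A i j := by
    rw [div_mul_eq_mul_div, le_div_iff₀ hκ] at hEV
    have : 1 * wEV j < κ * A i j * wEV j := by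
      nlinarith [mul_le_mul_of_nonneg_left hEV hκ.le]
    exact lt_of_mul_lt_mul_right this (hEVpos j).le
  rw [hGM i, hGM j]
  refine geom_mean_lt_of_row_lt hpos fun k => ?_
  nlinarith [hlower i k j, mul_lt_mul_of_pos_right hscale (hpos j k)]
end

section
/- Let A be an n×n pairwise comparison matrix, let w_EV and w_GM be the eigenvalue and geometric mean priority vectors, and suppose the objects are indexed so that w_EV is strictly decreasing: (w_EV)_1 > (w_EV)_2 > … > (w_EV)_n. Let d* = (w_EV)_1 − (w_EV)_2 and κ = 1 − KI(A). If d* > 1/κ² − 1, then the object ranked first by the EV method is also ranked first by the GM method; that is, (w_GM)_1 > (w_GM)_j for all j ≠ 1. -/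
/-- Proposition 2: Let `A` be an `n × n` pairwise comparison matrix with
eigenvalue priority vector `wEV` (strictly decreasing in the chosen indexing) and geometric
mean priority vector `wGM`. Let `d* = wEV 1 - wEV 2` (the gap between the two top EV
weights) and `κ = 1 - KI(A)`. If `d* > 1/κ² - 1`, then the object ranked first by the EV
method is also ranked first by the GM method. -/
theorem stmt_2 (n : ℕ) (hn : 2 ≤ n) (A : Matrix (Fin n) (Fin n) ℝ)
    (hpos : ∀ i j, 0 < A i j)
    (hrec : ∀ i j, A j i = 1 / A i j)
    -- Koczkodaj's inconsistency index `KI(A)`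
    (KI : ℝ)
    (hKI : IsGreatest
      {x : ℝ | ∃ i j k : Fin n,
        x = 1 - min (A i j / (A i k * A k j)) ((A i k * A k j) / A i j)} KI)
    -- the eigenvalue (EV) priority vector: positive, normalized, eigenvector of the
    -- largest (Perron) eigenvalue `lam`
    (wEV : Fin n → ℝ) (lam : ℝ)
    (hEVpos : ∀ i, 0 < wEV i)
    (hEVsum : ∑ i, wEV i = 1)
    (hEVeig : A.mulVec wEV = lam • wEV)
    (hlamMax : ∀ (μ : ℝ) (v : Fin n → ℝ), v ≠ 0 → A.mulVec v = μ • v → μ ≤ lam)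
    -- the indexing is such that `wEV` is strictly decreasing
    (hdec : ∀ i j : Fin n, i < j → wEV j < wEV i)
    -- the geometric mean (GM) priority vector
    (wGM : Fin n → ℝ)
    (hGM : ∀ i, wGM i =
      (∏ k, A i k) ^ ((n : ℝ)⁻¹) / ∑ j, (∏ k, A j k) ^ ((n : ℝ)⁻¹))
    -- `d*` is the gap between the largest and the second largest EV weight
    (dstar : ℝ)
    (hdstar : dstar = wEV ⟨0, by omega⟩ - wEV ⟨1, by omega⟩)
    -- the sufficient condition `d* > 1/κ² - 1`
    (hcond : dstar > 1 / (1 - KI) ^ 2 - 1) :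
    ∀ j : Fin n, j ≠ ⟨0, by omega⟩ → wGM ⟨0, by omega⟩ > wGM j := by
  intro j hj
  set o : Fin n := ⟨0, by omega⟩
  set κ : ℝ := 1 - KI with hκ
  have hdiag : A o o = 1 := by
    have h := hrec o o
    have hp := hpos o o
    rw [eq_div_iff hp.ne'] at h
    nlinarith
  have hκpos : 0 < κ := by
    obtain ⟨a, b, c, h⟩ := hKI.1
    have hac := mul_pos (hpos a c) (hpos c b)
    have hmin := lt_min (div_pos (hpos a b) hac) (div_pos hac (hpos a b))
    linarith
  have hκle : κ ≤ 1 := by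
    have h := hKI.2 ⟨o, o, o, rfl⟩
    norm_num [hdiag] at h
    linarith
  have htriple : ∀ a b c, κ ≤ min (A a b / (A a c * A c b)) ((A a c * A c b) / A a b) := by
    intro a b c
    have h := hKI.2 ⟨a, b, c, rfl⟩
    linarith
  have hlower : ∀ k, κ * (A o j * A j k) ≤ A o k := fun k =>
    (le_div_iff₀ (mul_pos (hpos o j) (hpos j k))).1 ((htriple o k j).trans (min_le_left _ _))
  have hupper : ∀ k, κ * A o k ≤ A o j * A j k := fun k =>
    (le_div_iff₀ (hpos o k)).1 ((htriple o k j).trans (min_le_right _ _))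
  have heig : ∀ i, ∑ k, A i k * wEV k = lam * wEV i := fun i => congrFun hEVeig i
  have hlam : 0 < lam := by
    have h : 0 < lam * wEV o := by
      rw [← heig o]
      exact Finset.sum_pos (fun k _ => mul_pos (hpos o k) (hEVpos k)) ⟨o, Finset.mem_univ o⟩
    exact pos_of_mul_pos_left h (hEVpos o).le
  -- the upper bounds on the first row, summed against `wEV`, bound the ratio of the EV weights
  have hEVratio : κ * wEV o ≤ A o j * wEV j := by
    have h : κ * (lam * wEV o) ≤ A o j * (lam * wEV j) := by
      rw [← heig o, ← heig j, Finset.mul_sum, Finset.mul_sum]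
      refine Finset.sum_le_sum fun k _ => ?_
      nlinarith [mul_le_mul_of_nonneg_right (hupper k) (hEVpos k).le]
    nlinarith
  have hgap : wEV j < κ ^ 2 * wEV o := by
    have hj1 : wEV j ≤ wEV ⟨1, by omega⟩ := by
      have hjpos : j.val ≠ 0 := fun h => hj (Fin.ext h)
      rcases (show (⟨1, by omega⟩ : Fin n) ≤ j from Nat.one_le_iff_ne_zero.2 hjpos).eq_or_lt
        with h | h
      · rw [h]
      · exact (hdec _ _ h).le
    have hjle : wEV j ≤ 1 :=
      hEVsum ▸ Finset.single_le_sum (fun i _ => (hEVpos i).le) (Finset.mem_univ j)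
    have hsq : 0 < κ ^ 2 := by positivity
    have hinv : 1 ≤ 1 / κ ^ 2 := one_le_one_div hsq (pow_le_one₀ hκpos.le hκle)
    have h : wEV j * (1 / κ ^ 2) < wEV o := by nlinarith
    rw [mul_one_div, div_lt_iff₀ hsq] at h
    linarith
  have hfactor : 1 < κ * A o j := by
    have h : wEV j * 1 < wEV j * (κ * A o j) := by nlinarith
    exact lt_of_mul_lt_mul_left h (hEVpos j).le
  have hrow : ∀ k, A j k < A o k := fun k => by
    nlinarith [hlower k, mul_lt_mul_of_pos_right hfactor (hpos j k)]
  have hprod : ∏ k, A j k < ∏ k, A o k :=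
    Finset.prod_lt_prod_of_nonempty (fun k _ => hpos j k) (fun k _ => hrow k)
      ⟨o, Finset.mem_univ o⟩
  rw [gt_iff_lt, hGM, hGM]
  refine div_lt_div_of_pos_right ?_ ?_
  · exact Real.rpow_lt_rpow (Finset.prod_pos fun k _ => hpos j k).le hprod
      (inv_pos.2 (Nat.cast_pos.2 (by omega)))
  · exact Finset.sum_pos
      (fun i _ => Real.rpow_pos_of_pos (Finset.prod_pos fun k _ => hpos i k) _)
      ⟨o, Finset.mem_univ o⟩
end

section
/- Let A be an n×n pairwise comparison matrix with eigenvalue priority vector w_EV and geometric mean priority vector w_GM, each having pairwise distinct entries. Index the objects so that w_EV is strictly decreasing, let d = min over i of ((w_EV)_i − (w_EV)_{i+1}), κ = 1 − KI(A), and K = 1/κ² − 1. Let k be an integer with 0 ≤ k ≤ n(n−1)/2, k·d < K and (k+1)·d > K. Then Kendall's rank correlation coefficient between the rankings induced by w_EV and w_GM satisfies τ ≥ (C(n,2) − 2k)/C(n,2), where C(n,2) = n(n−1)/2. -/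
/-- If consecutive values of `w` drop by at least `d`, values at distance `m` drop by at
least `m * d`. -/
theorem mul_le_sub_of_adjacent_gap {n : ℕ} {w : Fin n → ℝ} {d : ℝ}
    (hd : ∀ (i : Fin n) (h : (i : ℕ) + 1 < n), d ≤ w i - w ⟨(i : ℕ) + 1, h⟩)
    (i : Fin n) (m : ℕ) (h : (i : ℕ) + m < n) :
    (m : ℝ) * d ≤ w i - w ⟨(i : ℕ) + m, h⟩ := by
  induction m with
  | zero => simp
  | succ m ih =>
    have h₁ := ih (by omega)
    have h₂ := hd ⟨(i : ℕ) + m, by omega⟩ (by simpa [add_assoc] using h)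
    simp only [add_assoc] at h₂
    push_cast
    linarith

/-- The elements `i < j` satisfying `P` number at most `j - i`, for some such `i` (namely
the least one). -/
theorem exists_card_filter_lt_le_sub {n : ℕ} (j : Fin n) (P : Fin n → Prop) [DecidablePred P]
    (hne : (Finset.univ.filter fun i => i < j ∧ P i).Nonempty) :
    ∃ i, i < j ∧ P i ∧
      (Finset.univ.filter fun i => i < j ∧ P i).card ≤ (j : ℕ) - i := by
  have hmem := Finset.min'_mem _ hne
  set i₀ := (Finset.univ.filter fun i => i < j ∧ P i).min' hne
  obtain ⟨-, hlt, hP⟩ := Finset.mem_filter.1 hmem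
  refine ⟨i₀, hlt, hP, ?_⟩
  rw [← Fin.card_Ico]
  refine Finset.card_le_card fun i hi => Finset.mem_Ico.2 ⟨Finset.min'_le _ _ hi, ?_⟩
  exact (Finset.mem_filter.1 hi).2.1

/-- Twice the number of pairs `i < j` in `Fin n` is `n * (n - 1)`. -/
theorem two_mul_sum_card_filter_lt (n : ℕ) :
    2 * ∑ j : Fin n, ((Finset.univ.filter fun i => i < j).card : ℝ) = (n : ℝ) * ((n : ℝ) - 1) := by
  have h : ∀ j : Fin n, ((Finset.univ.filter fun i => i < j).card : ℝ) = ((j : ℕ) : ℝ) := by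
    intro j
    rw [Finset.filter_gt_eq_Iio, Fin.card_Iio]
  simp only [h]
  rw [Fin.sum_univ_eq_sum_range fun m => (m : ℝ)]
  induction n with
  | zero => simp
  | succ n ih =>
    rw [Finset.sum_range_succ, mul_add, ih fun j => by
      rw [Finset.filter_gt_eq_Iio, Fin.card_Iio]]
    push_cast
    ring

/-- The sum of sign products over pairs, when the first vector is strictly decreasing and the
second injective, is the number of pairs minus twice the number of discordant pairs. -/
theorem sum_sign_mul_sign_eq {n : ℕ} {w v : Fin n → ℝ}
    (hw : ∀ i j : Fin n, i < j → w j < w i) (hv : Function.Injective v) :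
    ∑ p ∈ Finset.univ.filter (fun p : Fin n × Fin n => p.1 < p.2),
        Real.sign (w p.1 - w p.2) * Real.sign (v p.1 - v p.2) =
      (n : ℝ) * ((n : ℝ) - 1) / 2 -
        2 * ∑ j : Fin n, ((Finset.univ.filter fun i => i < j ∧ v i < v j).card : ℝ) := by
  rw [← two_mul_sum_card_filter_lt, mul_div_cancel_left₀ _ two_ne_zero, Finset.mul_sum,
    ← Finset.sum_sub_distrib, Finset.sum_filter, Fintype.sum_prod_type_right]
  refine Finset.sum_congr rfl fun j _ => ?_
  simp only [Finset.card_filter, Nat.cast_sum]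
  rw [Finset.mul_sum, ← Finset.sum_sub_distrib]
  refine Finset.sum_congr rfl fun i _ => ?_
  by_cases hij : i < j
  · have h₁ := Real.sign_of_pos (sub_pos.2 (hw i j hij))
    rcases lt_or_gt_of_ne (hv.ne hij.ne) with hlt | hgt
    · have h₂ := Real.sign_of_neg (sub_neg.2 hlt)
      simp [hij, hlt, h₁, h₂]
      norm_num
    · have h₂ := Real.sign_of_pos (sub_pos.2 hgt)
      simp [hij, hgt.not_gt, h₁, h₂]
  · simp [hij]

/-- If `κ` bounds the inconsistency of all triads of a positive matrix, then an inversion of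
the row products of rows `i` and `j` bounds the ratio of the corresponding entries of a
positive eigenvector. -/
theorem sq_mul_eigenvector_lt_of_prod_lt {ι : Type*} [Fintype ι] [Nonempty ι]
    {A : Matrix ι ι ℝ} {κ lam : ℝ} {w : ι → ℝ} (hA : ∀ i j, 0 < A i j) (hκ : 0 < κ)
    (hlow : ∀ i j k, κ * (A i j * A j k) ≤ A i k)
    (hupp : ∀ i j k, κ * A i k ≤ A i j * A j k)
    (hw : ∀ i, 0 < w i) (heig : A.mulVec w = lam • w) {i j : ι}
    (hprod : ∏ k, A i k < ∏ k, A j k) : κ ^ 2 * w i < w j := by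
  have hrow : ∀ i, ∑ k, A i k * w k = lam * w i := fun i => by
    simpa [Matrix.mulVec, dotProduct] using congrFun heig i
  have hlam : 0 < lam := by
    have h : 0 < lam * w i := by
      rw [← hrow i]
      exact Finset.sum_pos (fun k _ => mul_pos (hA i k) (hw k)) Finset.univ_nonempty
    exact pos_of_mul_pos_left h (hw i).le
  have hentry : κ * A i j < 1 := by
    by_contra! h
    refine hprod.not_ge (Finset.prod_le_prod (fun k _ => (hA j k).le) fun k _ => ?_)
    nlinarith [hlow i j k, hA j k]
  have hratio : κ * w i ≤ A i j * w j := by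
    refine le_of_mul_le_mul_left ?_ hlam
    calc lam * (κ * w i) = ∑ k, κ * A i k * w k := by
          rw [mul_left_comm, ← hrow i, Finset.mul_sum]
          simp only [mul_assoc]
      _ ≤ ∑ k, A i j * A j k * w k :=
          Finset.sum_le_sum fun k _ => mul_le_mul_of_nonneg_right (hupp i j k) (hw k).le
      _ = lam * (A i j * w j) := by
          rw [mul_left_comm, ← hrow j, Finset.mul_sum]
          simp only [mul_assoc]
  nlinarith [hw j]


/-- Proposition 3: Let `A` be an `n × n` pairwise comparison matrix with
eigenvalue priority vector `wEV` (strictly decreasing in the chosen indexing) and geometric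
mean priority vector `wGM`, each with pairwise distinct entries. Let `d` be the minimum
adjacent gap of `wEV`, `κ = 1 - KI(A)`, `K = 1/κ² - 1`, and let `k` be an integer with
`0 ≤ k ≤ n(n-1)/2`, `k·d < K` and `(k+1)·d > K`. Then Kendall's rank correlation
coefficient between the rankings induced by `wEV` and `wGM` satisfies
`τ ≥ (C(n,2) - 2k) / C(n,2)` where `C(n,2) = n(n-1)/2`. -/
theorem stmt_4 (n : ℕ) (A : Matrix (Fin n) (Fin n) ℝ)
    (hpos : ∀ i j, 0 < A i j)
    (hrec : ∀ i j, A j i = 1 / A i j)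
    -- Koczkodaj's inconsistency index `KI(A)`
    (KI : ℝ)
    (hKI : IsGreatest
      {x : ℝ | ∃ i j k : Fin n,
        x = 1 - min (A i j / (A i k * A k j)) ((A i k * A k j) / A i j)} KI)
    -- the eigenvalue (EV) priority vector: positive, normalized, eigenvector of the
    -- largest (Perron) eigenvalue `lam`
    (wEV : Fin n → ℝ) (lam : ℝ)
    (hEVpos : ∀ i, 0 < wEV i)
    (hEVsum : ∑ i, wEV i = 1)
    (hEVeig : A.mulVec wEV = lam • wEV)
    (hlamMax : ∀ (μ : ℝ) (v : Fin n → ℝ), v ≠ 0 → A.mulVec v = μ • v → μ ≤ lam)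
    -- the indexing is such that `wEV` is strictly decreasing (in particular its entries
    -- are pairwise distinct)
    (hdec : ∀ i j : Fin n, i < j → wEV j < wEV i)
    -- the geometric mean (GM) priority vector, with pairwise distinct entries
    (wGM : Fin n → ℝ)
    (hGM : ∀ i, wGM i =
      (∏ k, A i k) ^ ((n : ℝ)⁻¹) / ∑ j, (∏ k, A j k) ^ ((n : ℝ)⁻¹))
    (hGMinj : Function.Injective wGM)
    -- `d` is the minimum gap between adjacent EV weights
    (d : ℝ)
    (hd : IsLeast
      {x : ℝ | ∃ i : Fin n, ∃ h : (i : ℕ) + 1 < n,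
        x = wEV i - wEV ⟨(i : ℕ) + 1, h⟩} d)
    -- `K = 1/κ² - 1` and the integer `k`
    (K : ℝ) (hK : K = 1 / (1 - KI) ^ 2 - 1)
    (k : ℕ) (hkle : 2 * k ≤ n * (n - 1))
    (hkd : (k : ℝ) * d < K)
    (hkd1 : ((k : ℝ) + 1) * d > K)
    -- Kendall's rank correlation coefficient `τ`
    (τ : ℝ)
    (hτ : τ = (2 / ((n : ℝ) * ((n : ℝ) - 1))) *
      ∑ p ∈ Finset.univ.filter (fun p : Fin n × Fin n => p.1 < p.2),
        Real.sign (wEV p.1 - wEV p.2) * Real.sign (wGM p.1 - wGM p.2)) :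
    τ ≥ ((n : ℝ) * ((n : ℝ) - 1) / 2 - 2 * (k : ℝ)) / ((n : ℝ) * ((n : ℝ) - 1) / 2) := by
  obtain ⟨⟨i₁, hi₁, hdeq⟩, hdle⟩ := hd
  have hn : 1 < n := by omega
  have : Nonempty (Fin n) := ⟨i₁⟩
  have hd0 : 0 < d := by
    rw [hdeq]
    exact sub_pos.2 (hdec _ _ (Fin.mk_lt_mk.2 (Nat.lt_succ_self _)))
  have hκ : 0 < 1 - KI := by
    obtain ⟨a, b, c, h⟩ := hKI.1
    have hac := mul_pos (hpos a c) (hpos c b)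
    have hmin := lt_min (div_pos (hpos a b) hac) (div_pos hac (hpos a b))
    linarith
  have htriad : ∀ a b c, 1 - KI ≤ min (A a c / (A a b * A b c)) ((A a b * A b c) / A a c) :=
    fun a b c => by linarith [hKI.2 ⟨a, c, b, rfl⟩]
  have hlow : ∀ a b c, (1 - KI) * (A a b * A b c) ≤ A a c := fun a b c =>
    (le_div_iff₀ (mul_pos (hpos a b) (hpos b c))).1 ((htriad a b c).trans (min_le_left _ _))
  have hupp : ∀ a b c, (1 - KI) * A a c ≤ A a b * A b c := fun a b c =>
    (le_div_iff₀ (hpos a c)).1 ((htriad a b c).trans (min_le_right _ _))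
  have hprod : ∀ i, 0 < ∏ l, A i l := fun i => Finset.prod_pos fun l _ => hpos i l
  have hprod_lt : ∀ i j, wGM i < wGM j → ∏ l, A i l < ∏ l, A j l := by
    intro i j hij
    by_contra! h
    refine hij.not_ge ?_
    rw [hGM i, hGM j]
    refine div_le_div_of_nonneg_right ?_
      (Finset.sum_nonneg fun l _ => Real.rpow_nonneg (hprod l).le _)
    exact Real.rpow_le_rpow (hprod j).le h (by positivity)
  have hdisc : ∀ i j, wGM i < wGM j → wEV i - wEV j < ((k : ℝ) + 1) * d * wEV j := by
    intro i j hij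
    have h := sq_mul_eigenvector_lt_of_prod_lt hpos hκ hlow hupp hEVpos hEVeig (hprod_lt i j hij)
    rw [mul_comm, ← lt_div_iff₀ (pow_pos hκ 2), div_eq_mul_one_div] at h
    have hK' : 1 / (1 - KI) ^ 2 = K + 1 := by linarith
    rw [hK'] at h
    nlinarith [hEVpos j]
  have hcard : ∀ j, (Finset.univ.filter fun i => i < j ∧ wGM i < wGM j).Nonempty →
      ((Finset.univ.filter fun i => i < j ∧ wGM i < wGM j).card : ℝ) <
        ((k : ℝ) + 1) * wEV j := by
    intro j hne
    obtain ⟨i, hij, hlt, hle⟩ := exists_card_filter_lt_le_sub j (fun i => wGM i < wGM j) hne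
    have hval : (i : ℕ) + ((j : ℕ) - i) = j := Nat.add_sub_of_le (Fin.le_def.1 hij.le)
    have hgap := mul_le_sub_of_adjacent_gap (fun a h => hdle ⟨a, h, rfl⟩) i ((j : ℕ) - i)
      (by omega)
    simp only [hval, Fin.eta] at hgap
    refine (Nat.cast_le.2 hle).trans_lt (lt_of_mul_lt_mul_right ?_ hd0.le)
    linarith [hdisc i j hlt]
  have hcount :
      ∑ j : Fin n, ((Finset.univ.filter fun i => i < j ∧ wGM i < wGM j).card : ℝ) ≤ k := by
    have hle : ∑ j : Fin n, ((Finset.univ.filter fun i => i < j ∧ wGM i < wGM j).card : ℝ) <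
        (k : ℝ) + 1 := by
      have hsum : ∑ j, ((k : ℝ) + 1) * wEV j = (k : ℝ) + 1 := by
        rw [← Finset.mul_sum, hEVsum, mul_one]
      rw [← hsum]
      refine Finset.sum_lt_sum_of_nonempty Finset.univ_nonempty fun j _ => ?_
      rcases Finset.eq_empty_or_nonempty
        (Finset.univ.filter fun i => i < j ∧ wGM i < wGM j) with h | h
      · rw [h, Finset.card_empty, Nat.cast_zero]
        exact mul_pos (by positivity) (hEVpos j)
      · exact hcard j h
    exact_mod_cast Nat.lt_succ_iff.1 (by exact_mod_cast hle)
  have hn' : 0 < (n : ℝ) * ((n : ℝ) - 1) := by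
    have : (1 : ℝ) < n := by exact_mod_cast hn
    exact mul_pos (by linarith) (by linarith)
  rw [hτ, sum_sign_mul_sign_eq hdec hGMinj, ge_iff_le, div_le_iff₀ (by positivity)]
  rw [mul_right_comm, div_mul_div_cancel₀' two_ne_zero, div_self hn'.ne', one_mul]
  linarith
end

section
/- Let A be an n×n pairwise comparison matrix with eigenvalue priority vector w_EV and geometric mean priority vector w_GM, each having pairwise distinct entries. Index the objects so that w_EV is strictly decreasing, let d = min over i of ((w_EV)_i − (w_EV)_{i+1}), κ = 1 − KI(A), and K = 1/κ² − 1. Let k be an integer with 0 ≤ k ≤ n(n−1)/2, k·d < K and (k+1)·d > K. Then Spearman's rank correlation coefficient between the rankings induced by w_EV and w_GM satisfies ρ ≥ 1 − 6(k² + k)/(n(n² − 1)). -/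
open Finset

/-- A sequence of length `m + 1` whose first term has square at most `c` and whose term of index
`i` has absolute value at most `c / (i + 1)` has sum of squares at most
`c + c ^ 2 * (1 - 1 / (m + 1))`. -/
theorem sum_sq_le_of_succ_mul_abs_le {c : ℝ} :
    ∀ (m : ℕ) (D : Fin (m + 1) → ℝ), D 0 ^ 2 ≤ c →
      (∀ i : Fin (m + 1), ((i : ℕ) + 1 : ℝ) * |D i| ≤ c) →
      ∑ i, D i ^ 2 ≤ c + c ^ 2 * (1 - 1 / ((m : ℝ) + 1)) := by
  intro m
  induction m with
  | zero => intro D h0 _; simpa using h0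
  | succ m ih =>
    intro D h0 h
    rw [Fin.sum_univ_castSucc]
    have h1 := ih (fun i => D i.castSucc) (by simpa using h0) (fun i => by simpa using h i.castSucc)
    have h2 := h (Fin.last (m + 1))
    simp only [Fin.val_last] at h2
    push_cast at h2 ⊢
    have hm : (0 : ℝ) ≤ m := Nat.cast_nonneg m
    have h3 : D (Fin.last (m + 1)) ^ 2 ≤ c ^ 2 / ((m : ℝ) + 1 + 1) ^ 2 := by
      rw [le_div_iff₀ (by positivity), ← sq_abs, ← mul_pow, mul_comm]
      exact pow_le_pow_left₀ (by positivity) h2 2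
    have h4 : c ^ 2 / ((m : ℝ) + 1 + 1) ^ 2 ≤
        c ^ 2 * (1 / ((m : ℝ) + 1) - 1 / ((m : ℝ) + 1 + 1)) := by
      rw [div_eq_mul_one_div]
      refine mul_le_mul_of_nonneg_left ?_ (sq_nonneg c)
      rw [div_sub_div _ _ (by positivity) (by positivity),
        div_le_div_iff₀ (by positivity) (by positivity)]
      nlinarith
    linarith

section Inversions

variable {n : ℕ} {f : Fin n → ℝ} {k : ℕ}

theorem card_later_above_bound
    (hinv : ∀ i j : Fin n, i < j → f i < f j → ((j : ℕ) + 1) * ((j : ℕ) - i) ≤ k) (i : Fin n) :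
    ((i : ℕ) + #{j | i < j ∧ f i < f j} + 1) * #{j | i < j ∧ f i < f j} ≤ k := by
  set S : Finset (Fin n) := {j | i < j ∧ f i < f j} with hS
  rcases Nat.eq_zero_or_pos #S with h0 | hpos
  · simp [h0]
  have hex : ∃ j ∈ S, (i : ℕ) + #S ≤ j := by
    by_contra! hcon
    have hle : #S ≤ #(Ioo (i : ℕ) (i + #S)) := by
      refine card_le_card_of_injOn Fin.val (fun j hj => ?_) Fin.val_injective.injOn
      have hj' : j ∈ S := hj
      have hij : i < j := (mem_filter.1 hj').2.1
      exact mem_coe.2 (mem_Ioo.2 ⟨hij, hcon j hj'⟩)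
    rw [Nat.card_Ioo] at hle
    omega
  obtain ⟨j, hj, hle⟩ := hex
  obtain ⟨hij, hf⟩ := (mem_filter.1 hj).2
  exact (Nat.mul_le_mul (by omega) (by omega)).trans (hinv i j hij hf)

theorem card_earlier_below_bound
    (hinv : ∀ i j : Fin n, i < j → f i < f j → ((j : ℕ) + 1) * ((j : ℕ) - i) ≤ k) (i : Fin n) :
    ((i : ℕ) + 1) * #{j | j < i ∧ f j < f i} ≤ k := by
  set S : Finset (Fin n) := {j | j < i ∧ f j < f i} with hS
  rcases Nat.eq_zero_or_pos #S with h0 | hpos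
  · simp [h0]
  have hex : ∃ j ∈ S, (j : ℕ) + #S ≤ i := by
    by_contra! hcon
    have hle : #S ≤ #(Ico ((i : ℕ) + 1 - #S) i) := by
      refine card_le_card_of_injOn Fin.val (fun j hj => ?_) Fin.val_injective.injOn
      have hj' : j ∈ S := hj
      have hji : j < i := (mem_filter.1 hj').2.1
      have hlt := hcon j hj'
      exact mem_coe.2 (mem_Ico.2 ⟨by omega, hji⟩)
    rw [Nat.card_Ico] at hle
    omega
  obtain ⟨j, hj, hle⟩ := hex
  obtain ⟨hji, hf⟩ := (mem_filter.1 hj).2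
  exact (Nat.mul_le_mul le_rfl (by omega)).trans (hinv j i hji hf)

theorem card_above_add_card_earlier_below (hf : Function.Injective f) (i : Fin n) :
    #{j | f i < f j} + #{j | j < i ∧ f j < f i} = i + #{j | i < j ∧ f i < f j} := by
  have h1 : #{j | f i < f j} = #{j | j < i ∧ f i < f j} + #{j | i < j ∧ f i < f j} := by
    rw [← card_union_of_disjoint]
    · congr 1
      ext j
      simp only [mem_filter, mem_univ, true_and, mem_union]
      constructor
      · intro h
        rcases lt_trichotomy j i with hji | rfl | hij
        · exact Or.inl ⟨hji, h⟩
        · exact absurd h (lt_irrefl _)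
        · exact Or.inr ⟨hij, h⟩
      · rintro (h | h) <;> exact h.2
    · rw [disjoint_filter]
      intro j _ h h'
      exact lt_asymm h.1 h'.1
  have h2 : (i : ℕ) = #{j | j < i ∧ f i < f j} + #{j | j < i ∧ f j < f i} := by
    rw [← Fin.card_Iio i, ← card_union_of_disjoint]
    · congr 1
      ext j
      simp only [mem_filter, mem_univ, true_and, mem_union, mem_Iio]
      constructor
      · intro h
        rcases lt_or_gt_of_ne (hf.ne h.ne) with h' | h'
        · exact Or.inr ⟨h, h'⟩
        · exact Or.inl ⟨h, h'⟩
      · rintro (h | h) <;> exact h.1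
    · rw [disjoint_filter]
      intro j _ h h'
      exact lt_asymm h.2 h'.2
  omega

/-- If every inversion `i < j`, `f i < f j` satisfies `(j + 1) * (j - i) ≤ k`, then the squared rank
displacements of `f` relative to the decreasing order sum to at most `k ^ 2 + k`. -/
theorem sum_sq_rank_displacement_le (hf : Function.Injective f)
    (hinv : ∀ i j : Fin n, i < j → f i < f j → ((j : ℕ) + 1) * ((j : ℕ) - i) ≤ k) :
    ∑ i : Fin n, (((i : ℕ) : ℝ) - #{j | f i < f j}) ^ 2 ≤ (k : ℝ) ^ 2 + k := by
  rcases n with _ | m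
  · simp only [univ_eq_empty, sum_empty]; positivity
  have hdisp (i : Fin (m + 1)) : ((i : ℕ) : ℝ) - #{j | f i < f j} =
      (#{j | j < i ∧ f j < f i} : ℝ) - #{j | i < j ∧ f i < f j} := by
    have h : (_ : ℝ) = _ := congrArg Nat.cast (card_above_add_card_earlier_below hf i)
    push_cast at h
    linarith
  have hlater (i : Fin (m + 1)) : (((i : ℕ) : ℝ) + #{j | i < j ∧ f i < f j} + 1) *
      #{j | i < j ∧ f i < f j} ≤ k := by
    exact_mod_cast card_later_above_bound hinv i
  have hearlier (i : Fin (m + 1)) : (((i : ℕ) : ℝ) + 1) * #{j | j < i ∧ f j < f i} ≤ k := by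
    exact_mod_cast card_earlier_below_bound hinv i
  have hsum := sum_sq_le_of_succ_mul_abs_le (c := k) m
    (fun i => ((i : ℕ) : ℝ) - #{j | f i < f j}) ?_ ?_
  · have hfrac : 0 ≤ (k : ℝ) ^ 2 * (1 / ((m : ℝ) + 1)) := by positivity
    linarith
  · have h0 := hlater 0
    have hv : #{j | j < (0 : Fin (m + 1)) ∧ f j < f 0} = 0 := by simp
    simp only [hdisp, hv]
    simp only [Fin.val_zero, Nat.cast_zero, zero_sub, zero_add] at h0 ⊢
    nlinarith [Nat.cast_nonneg (α := ℝ) #{j | (0 : Fin (m + 1)) < j ∧ f 0 < f j}]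
  · intro i
    simp only [hdisp]
    have hu := hlater i
    have hv := hearlier i
    generalize #{j | i < j ∧ f i < f j} = u at hu ⊢
    generalize #{j | j < i ∧ f j < f i} = v at hv ⊢
    have hu0 : (0 : ℝ) ≤ u := Nat.cast_nonneg _
    have hv0 : (0 : ℝ) ≤ v := Nat.cast_nonneg _
    have hi0 : (0 : ℝ) ≤ ((i : ℕ) : ℝ) := Nat.cast_nonneg _
    rcases abs_cases ((v : ℝ) - u) with ⟨h, _⟩ | ⟨h, _⟩ <;> rw [h] <;> nlinarith

end Inversions

section PairwiseComparison

variable {n : ℕ} {A : Matrix (Fin n) (Fin n) ℝ} {κ : ℝ}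

theorem mul_eigenvector_le (hcons : ∀ i j k, κ * A i k ≤ A i j * A j k)
    {w : Fin n → ℝ} {lam : ℝ} (hpos : ∀ i j, 0 < A i j) (hw : ∀ i, 0 < w i)
    (heig : A.mulVec w = lam • w) (i j : Fin n) : κ * w i ≤ A i j * w j := by
  have happ (l : Fin n) : ∑ m, A l m * w m = lam * w l := congrFun heig l
  have hlam : 0 < lam := by
    have h : 0 < lam * w i :=
      happ i ▸ sum_pos (fun m _ => mul_pos (hpos i m) (hw m)) ⟨i, mem_univ i⟩
    exact pos_of_mul_pos_left h (hw i).le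
  have h : κ * (lam * w i) ≤ A i j * (lam * w j) := by
    rw [← happ, ← happ, mul_sum, mul_sum]
    refine sum_le_sum fun m _ => ?_
    rw [← mul_assoc, ← mul_assoc]
    exact mul_le_mul_of_nonneg_right (hcons i j m) (hw m).le
  refine le_of_mul_le_mul_left ?_ hlam
  linarith

theorem mul_lt_one_of_prod_lt (hpos : ∀ i j, 0 < A i j)
    (hcons : ∀ i j k, κ * (A i j * A j k) ≤ A i k) {i j : Fin n}
    (hlt : ∏ m, A i m < ∏ m, A j m) : κ * A i j < 1 := by
  by_contra! hge
  refine hlt.not_ge (prod_le_prod (fun m _ => (hpos j m).le) fun m _ => ?_)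
  have h := hcons i j m
  nlinarith [hpos j m]

end PairwiseComparison

theorem mul_gap_le_sub {n : ℕ} {w : Fin n → ℝ} {d : ℝ}
    (hgap : ∀ (i : Fin n) (h : (i : ℕ) + 1 < n), d ≤ w i - w ⟨(i : ℕ) + 1, h⟩) (i : Fin n) :
    ∀ (t : ℕ) (h : (i : ℕ) + t < n), t * d ≤ w i - w ⟨(i : ℕ) + t, h⟩ := by
  intro t
  induction t with
  | zero => intro h; simp
  | succ t ih =>
    intro h
    have h1 := ih (by omega)
    have h2 := hgap ⟨(i : ℕ) + t, by omega⟩ h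
    push_cast
    simp only [← add_assoc]
    linarith

theorem succ_mul_le_sum_of_antitone {n : ℕ} {w : Fin n → ℝ} (hw : ∀ i, 0 < w i)
    (hanti : Antitone w) (j : Fin n) : ((j : ℕ) + 1 : ℝ) * w j ≤ ∑ i, w i := by
  calc ((j : ℕ) + 1 : ℝ) * w j = ∑ _i ∈ Iic j, w j := by
        rw [sum_const, Fin.card_Iic, nsmul_eq_mul]; push_cast; rfl
    _ ≤ ∑ i ∈ Iic j, w i := sum_le_sum fun i hi => hanti (mem_Iic.1 hi)
    _ ≤ ∑ i, w i := sum_le_sum_of_subset_of_nonneg (subset_univ _) fun i _ _ => (hw i).le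

/-- Proposition 4: Let `A` be an `n × n` pairwise comparison matrix with
eigenvalue priority vector `wEV` (strictly decreasing in the chosen indexing) and geometric
mean priority vector `wGM`, each with pairwise distinct entries. Let `d` be the minimum
adjacent gap of `wEV`, `κ = 1 - KI(A)`, `K = 1/κ² - 1`, and let `k` be an integer with
`0 ≤ k ≤ n(n-1)/2`, `k·d < K` and `(k+1)·d > K`. Then Spearman's rank correlation
coefficient between the rankings induced by `wEV` and `wGM` (where the rank of object `i`
under `w` is `#{j : w j > w i} + 1`) satisfies `ρ ≥ 1 - 6(k² + k)/(n(n² - 1))`. -/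
theorem stmt_5 (n : ℕ) (A : Matrix (Fin n) (Fin n) ℝ)
    (hpos : ∀ i j, 0 < A i j)
    (hrec : ∀ i j, A j i = 1 / A i j)
    -- Koczkodaj's inconsistency index `KI(A)`
    (KI : ℝ)
    (hKI : IsGreatest
      {x : ℝ | ∃ i j k : Fin n,
        x = 1 - min (A i j / (A i k * A k j)) ((A i k * A k j) / A i j)} KI)
    -- the eigenvalue (EV) priority vector: positive, normalized, eigenvector of the
    -- largest (Perron) eigenvalue `lam`
    (wEV : Fin n → ℝ) (lam : ℝ)
    (hEVpos : ∀ i, 0 < wEV i)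
    (hEVsum : ∑ i, wEV i = 1)
    (hEVeig : A.mulVec wEV = lam • wEV)
    (hlamMax : ∀ (μ : ℝ) (v : Fin n → ℝ), v ≠ 0 → A.mulVec v = μ • v → μ ≤ lam)
    -- the indexing is such that `wEV` is strictly decreasing (in particular its entries
    -- are pairwise distinct)
    (hdec : ∀ i j : Fin n, i < j → wEV j < wEV i)
    -- the geometric mean (GM) priority vector, with pairwise distinct entries
    (wGM : Fin n → ℝ)
    (hGM : ∀ i, wGM i =
      (∏ k, A i k) ^ ((n : ℝ)⁻¹) / ∑ j, (∏ k, A j k) ^ ((n : ℝ)⁻¹))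
    (hGMinj : Function.Injective wGM)
    -- `d` is the minimum gap between adjacent EV weights
    (d : ℝ)
    (hd : IsLeast
      {x : ℝ | ∃ i : Fin n, ∃ h : (i : ℕ) + 1 < n,
        x = wEV i - wEV ⟨(i : ℕ) + 1, h⟩} d)
    -- `K = 1/κ² - 1` and the integer `k`
    (K : ℝ) (hK : K = 1 / (1 - KI) ^ 2 - 1)
    (k : ℕ) (hkle : 2 * k ≤ n * (n - 1))
    (hkd : (k : ℝ) * d < K)
    (hkd1 : ((k : ℝ) + 1) * d > K)
    -- Spearman's rank correlation coefficient `ρ`, computed from the ranks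
    -- `r_w i = #{j : w j > w i} + 1`
    (ρ : ℝ)
    (hρ : ρ = 1 - 6 * (∑ i : Fin n,
        (((Finset.univ.filter (fun j : Fin n => wEV j > wEV i)).card + 1 : ℝ) -
         ((Finset.univ.filter (fun j : Fin n => wGM j > wGM i)).card + 1 : ℝ)) ^ 2) /
      ((n : ℝ) * ((n : ℝ) ^ 2 - 1))) :
    ρ ≥ 1 - 6 * ((k : ℝ) ^ 2 + (k : ℝ)) / ((n : ℝ) * ((n : ℝ) ^ 2 - 1)) := by
  have hanti : StrictAnti wEV := fun i j h => hdec i j h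
  obtain ⟨i₀, hi₀, hd₀⟩ := hd.1
  have hd_pos : 0 < d := by
    rw [hd₀]
    exact sub_pos.2 (hdec _ _ (Fin.lt_def.2 (Nat.lt_succ_self _)))
  have hK_pos : 0 < K := lt_of_le_of_lt (by positivity) hkd
  set κ : ℝ := 1 - KI with hκ
  have hκ_le (i j l : Fin n) :
      κ ≤ min (A i j / (A i l * A l j)) ((A i l * A l j) / A i j) := by
    have h := hKI.2 ⟨i, j, l, rfl⟩
    linarith
  have hκ_pos : 0 < κ := by
    obtain ⟨i, j, l, h⟩ := hKI.1
    have hij := hpos i j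
    have hil := hpos i l
    have hlj := hpos l j
    rw [hκ, h, sub_sub_cancel]
    exact lt_min (by positivity) (by positivity)
  have hcons_upper (i j l : Fin n) : κ * A i l ≤ A i j * A j l :=
    (le_div_iff₀ (hpos i l)).1 ((hκ_le i l j).trans (min_le_right _ _))
  have hcons_lower (i j l : Fin n) : κ * (A i j * A j l) ≤ A i l :=
    (le_div_iff₀ (mul_pos (hpos i j) (hpos j l))).1 ((hκ_le i l j).trans (min_le_left _ _))
  have hinv (i j : Fin n) (hij : i < j) (hlt : wGM i < wGM j) :
      ((j : ℕ) + 1) * ((j : ℕ) - i) ≤ k := by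
    have hprod : ∏ m, A i m < ∏ m, A j m := by
      by_contra! hge
      refine hlt.not_ge ?_
      rw [hGM, hGM]
      have hprod_nonneg (l : Fin n) : 0 ≤ ∏ m, A l m := prod_nonneg fun m _ => (hpos l m).le
      exact div_le_div_of_nonneg_right
        (Real.rpow_le_rpow (hprod_nonneg j) hge (by positivity))
        (sum_nonneg fun l _ => Real.rpow_nonneg (hprod_nonneg l) _)
    have hlt_one := mul_lt_one_of_prod_lt hpos hcons_lower hprod
    have heig := mul_eigenvector_le hcons_upper hpos hEVpos hEVeig i j
    have hratio : κ ^ 2 * wEV i < wEV j := by nlinarith [hEVpos j]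
    have hratio' : wEV i < (K + 1) * wEV j := by
      rw [hK, sub_add_cancel, one_div_mul_eq_div, lt_div_iff₀ (by positivity)]
      linarith
    have hgap := mul_gap_le_sub (fun i h => hd.2 ⟨i, h, rfl⟩) i ((j : ℕ) - i) (by omega)
    have hj : (⟨(i : ℕ) + ((j : ℕ) - i), by omega⟩ : Fin n) = j := by
      ext; simp only; omega
    rw [hj] at hgap
    have hw := succ_mul_le_sum_of_antitone hEVpos hanti.antitone j
    rw [hEVsum] at hw
    have hmain : (((j : ℕ) + 1 : ℝ) * (((j : ℕ) - (i : ℕ) : ℕ) : ℝ)) * d < ((k : ℝ) + 1) * d := by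
      have h1 : (((j : ℕ) - (i : ℕ) : ℕ) : ℝ) * d ≤ K * wEV j := by linarith
      have h2 := mul_le_mul_of_nonneg_left h1 (by positivity : (0 : ℝ) ≤ ((j : ℕ) : ℝ) + 1)
      have h3 := mul_le_mul_of_nonneg_left hw hK_pos.le
      linarith
    have hnat := lt_of_mul_lt_mul_right hmain hd_pos.le
    exact Nat.lt_succ_iff.1 (by exact_mod_cast hnat)
  have hrank (i : Fin n) : #{j | wEV j > wEV i} = (i : ℕ) := by
    rw [← Fin.card_Iio i]
    congr 1
    ext j
    simp [hanti.lt_iff_gt]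
  have hsum := sum_sq_rank_displacement_le hGMinj hinv
  have hn : (2 : ℝ) ≤ n := by exact_mod_cast (by omega : 2 ≤ n)
  have hden : 0 < (n : ℝ) * ((n : ℝ) ^ 2 - 1) := mul_pos (by linarith) (by nlinarith)
  rw [hρ, ge_iff_le]
  refine sub_le_sub_left (div_le_div_of_nonneg_right ?_ hden.le) 1
  simp only [hrank, add_sub_add_right_eq_sub, gt_iff_lt]
  linarith
end

section
/- Let A be a 3×3 pairwise comparison matrix (not necessarily consistent). If v is a vector with strictly positive entries satisfying A·v = λ·v for some real λ, then v is a positive scalar multiple of the vector of row geometric means ((∏_k a_1k)^{1/3}, (∏_k a_2k)^{1/3}, (∏_k a_3k)^{1/3}); consequently the normalized eigenvalue priority vector equals the geometric mean priority vector for 3×3 PC matrices. -/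
/-- A `3 × 3` positive reciprocal matrix with upper entries `x, y, z` and equal row sums satisfies
`x * y = 1` and `z = x`, that is, all its row products are `1`. -/
lemma mul_eq_one_of_reciprocal_row_sums_eq {x y z : ℝ} (hx : 0 < x) (hy : 0 < y) (hz : 0 < z)
    (h₁₂ : x + y = x⁻¹ + z) (h₂₃ : x⁻¹ + z = y⁻¹ + z⁻¹) : x * y = 1 ∧ z = x := by
  have hxy : y = x⁻¹ := by
    rcases lt_trichotomy y x⁻¹ with h | h | h
    · have hzx : z < x := by linarith
      have hinv : x⁻¹ < z⁻¹ := inv_strictAnti₀ hz hzx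
      have hxy' : x < y⁻¹ := (lt_inv_comm₀ hy hx).1 h
      linarith
    · exact h
    · have hzx : x < z := by linarith
      have hinv : z⁻¹ < x⁻¹ := inv_strictAnti₀ hx hzx
      have hxy' : y⁻¹ < x := (inv_lt_comm₀ hx hy).1 h
      linarith
  exact ⟨by rw [hxy, mul_inv_cancel₀ hx.ne'], by linarith⟩

/-- The cube of each entry of a positive eigenvector of a `3 × 3` reciprocal matrix is the product
of all its entries times the corresponding row product. -/
lemma pow_three_eq_prod_mul_row_prod {A : Matrix (Fin 3) (Fin 3) ℝ}
    (hpos : ∀ i j, 0 < A i j) (hrec : ∀ i j, A j i = 1 / A i j) {v : Fin 3 → ℝ} {lam : ℝ}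
    (hvpos : ∀ i, 0 < v i) (hveig : A.mulVec v = lam • v) (i : Fin 3) :
    v i ^ 3 = (∏ j, v j) * ∏ k, A i k := by
  have hdiag : ∀ i, A i i = 1 := fun i ↦ by
    have h := hrec i i
    rw [eq_div_iff (hpos i i).ne'] at h
    nlinarith [hpos i i]
  have hrow : ∀ i, A i 0 * v 0 + A i 1 * v 1 + A i 2 * v 2 = lam * v i := fun i ↦ by
    simpa [Matrix.mulVec, dotProduct, Fin.sum_univ_three] using congrFun hveig i
  have h₀ := hrow 0
  have h₁ := hrow 1
  have h₂ := hrow 2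
  rw [hdiag] at h₀ h₁ h₂
  rw [hrec 0 1] at h₁
  rw [hrec 0 2, hrec 1 2] at h₂
  have ha := hpos 0 1
  have hb := hpos 0 2
  have hc := hpos 1 2
  have hp := hvpos 0
  have hq := hvpos 1
  have hr := hvpos 2
  have hx : A 0 1 * v 1 / v 0 + A 0 2 * v 2 / v 0 = lam - 1 := by
    field_simp
    linarith
  have hy : (A 0 1 * v 1 / v 0)⁻¹ + A 1 2 * v 2 / v 1 = lam - 1 := by
    have : lam = (1 / A 0 1 * v 0 + 1 * v 1 + A 1 2 * v 2) / v 1 := by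
      rw [h₁, mul_div_cancel_right₀ _ hq.ne']
    rw [this]
    field_simp
    ring
  have hz : (A 0 2 * v 2 / v 0)⁻¹ + (A 1 2 * v 2 / v 1)⁻¹ = lam - 1 := by
    have : lam = (1 / A 0 2 * v 0 + 1 / A 1 2 * v 1 + 1 * v 2) / v 2 := by
      rw [h₂, mul_div_cancel_right₀ _ hr.ne']
    rw [this]
    field_simp
    ring
  obtain ⟨hxy, hzx⟩ := mul_eq_one_of_reciprocal_row_sums_eq (by positivity) (by positivity)
    (by positivity) (hx.trans hy.symm) (hy.trans hz.symm)
  have e₁ : A 0 1 * v 1 * (A 0 2 * v 2) = v 0 ^ 2 := by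
    field_simp at hxy
    linarith
  have e₂ : A 1 2 * v 2 * v 0 = A 0 1 * v 1 ^ 2 := by
    field_simp at hzx
    linarith
  have e₃ : A 0 2 * A 1 2 * v 2 ^ 2 = v 0 * v 1 := by
    refine mul_left_cancel₀ (mul_pos (mul_pos ha hq) hp).ne' ?_
    linear_combination A 1 2 * v 2 * v 0 * e₁ + v 0 ^ 2 * e₂
  fin_cases i
  · simp only [Fin.prod_univ_three, Fin.zero_eta, hdiag]
    linear_combination -v 0 * e₁
  · simp only [Fin.prod_univ_three, Fin.mk_one, hdiag, hrec 0 1]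
    field_simp
    linear_combination -e₂
  · simp only [Fin.prod_univ_three, Fin.reduceFinMk, hdiag, hrec 0 2, hrec 1 2]
    field_simp
    linear_combination e₃


/-- Let `A` be a `3 × 3` pairwise comparison matrix (not necessarily
consistent). Every positive eigenvector `v` of `A` is a positive scalar multiple of the
vector of row geometric means `i ↦ (∏ k, A i k)^(1/3)`; consequently, if `v` is
normalized (`∑ i, v i = 1`), it equals the geometric mean priority vector. -/
theorem stmt_12 (A : Matrix (Fin 3) (Fin 3) ℝ)
    (hpos : ∀ i j, 0 < A i j)
    (hrec : ∀ i j, A j i = 1 / A i j)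
    (wGM : Fin 3 → ℝ)
    (hGM : ∀ i, wGM i =
      (∏ k, A i k) ^ ((3 : ℝ)⁻¹) / ∑ j, (∏ k, A j k) ^ ((3 : ℝ)⁻¹))
    (v : Fin 3 → ℝ) (lam : ℝ)
    (hvpos : ∀ i, 0 < v i)
    (hveig : A.mulVec v = lam • v) :
    (∃ c : ℝ, 0 < c ∧ ∀ i, v i = c * (∏ k, A i k) ^ ((3 : ℝ)⁻¹)) ∧
    (∑ i, v i = 1 → v = wGM) := by
  have hprod : ∀ i, 0 < ∏ k, A i k := fun i ↦ Finset.prod_pos fun k _ ↦ hpos i k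
  have hP : 0 < ∏ j, v j := Finset.prod_pos fun j _ ↦ hvpos j
  set c : ℝ := (∏ j, v j) ^ ((3 : ℝ)⁻¹) with hc_def
  have hc : 0 < c := Real.rpow_pos_of_pos hP _
  have hv : ∀ i, v i = c * (∏ k, A i k) ^ ((3 : ℝ)⁻¹) := fun i ↦ by
    rw [hc_def, ← Real.mul_rpow hP.le (hprod i).le,
      ← pow_three_eq_prod_mul_row_prod hpos hrec hvpos hveig i]
    exact_mod_cast (Real.pow_rpow_inv_natCast (hvpos i).le three_ne_zero).symm
  refine ⟨⟨c, hc, hv⟩, fun hsum ↦ funext fun i ↦ ?_⟩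
  have hsum' : c * ∑ j, (∏ k, A j k) ^ ((3 : ℝ)⁻¹) = 1 := by
    rw [Finset.mul_sum, ← hsum]
    exact Finset.sum_congr rfl fun j _ ↦ (hv j).symm
  rw [hGM i, hv i, eq_div_iff (right_ne_zero_of_mul_eq_one hsum')]
  linear_combination (∏ k, A i k) ^ ((3 : ℝ)⁻¹) * hsum'
end

section
/- Let A be an n×n pairwise comparison matrix and let v be a vector with strictly positive entries satisfying A·v = λ·v for some real λ. Then λ ≥ n. -/
/-- Let `A` be an `n × n` pairwise comparison matrix and let `v` be a
vector with strictly positive entries satisfying `A · v = λ · v` for some real `λ`.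
Then `λ ≥ n`. -/
theorem stmt_13 (n : ℕ) (hn : 0 < n) (A : Matrix (Fin n) (Fin n) ℝ)
    (hpos : ∀ i j, 0 < A i j)
    (hrec : ∀ i j, A j i = 1 / A i j)
    (v : Fin n → ℝ) (lam : ℝ)
    (hvpos : ∀ i, 0 < v i)
    (hveig : A.mulVec v = lam • v) :
    (n : ℝ) ≤ lam := by
  have hrow (i : Fin n) : ∑ j, A i j * v j / v i = lam := by
    have h := congrFun hveig i
    simp only [Matrix.mulVec, dotProduct, Pi.smul_apply, smul_eq_mul] at h
    rw [← Finset.sum_div, h, mul_div_cancel_right₀ _ (hvpos i).ne']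
  have hsum : ∑ i, ∑ j, A i j * v j / v i = n * lam := by
    simp [hrow]
  have hswap : ∑ i, ∑ j, A j i * v i / v j = n * lam := by
    rw [Finset.sum_comm, hsum]
  have hpair (i j : Fin n) : 2 ≤ A i j * v j / v i + A j i * v i / v j := by
    have hx : 0 < A i j * v j / v i := div_pos (mul_pos (hpos i j) (hvpos j)) (hvpos i)
    have hinv : A j i * v i / v j = (A i j * v j / v i)⁻¹ := by
      rw [hrec i j, inv_div]
      field_simp
    rw [hinv]
    generalize A i j * v j / v i = x at hx
    have hmul : x * x⁻¹ = 1 := mul_inv_cancel₀ hx.ne'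
    nlinarith [sq_nonneg (x - x⁻¹), inv_pos.mpr hx]
  have htotal : ∑ _i : Fin n, ∑ _j : Fin n, (2 : ℝ) ≤ n * lam + n * lam := by
    refine le_trans ?_ (congrArg₂ (· + ·) hsum hswap).le
    simp only [← Finset.sum_add_distrib]
    exact Finset.sum_le_sum fun i _ => Finset.sum_le_sum fun j _ => hpair i j
  simp only [Finset.sum_const, Finset.card_univ, Fintype.card_fin, nsmul_eq_mul] at htotal
  have hn' : (0 : ℝ) < n := Nat.cast_pos.mpr hn
  exact le_of_mul_le_mul_left (by linarith) hn'
end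

section
/- Let A be an n×n pairwise comparison matrix and let w_GM be its geometric mean priority vector. Then w_GM minimizes the logarithmic least squares objective: for every vector w with strictly positive entries summing to 1, ∑_{i=1}^n ∑_{j=1}^n (ln a_ij − ln((w_GM)_i/(w_GM)_j))² ≤ ∑_{i=1}^n ∑_{j=1}^n (ln a_ij − ln(w_i/w_j))². -/
/-- A matrix with vanishing row and column sums is orthogonal to every difference matrix
`d i - d j`, so subtracting such a matrix cannot decrease its sum of squares. -/
theorem sum_sq_le_sum_sub_diff_sq {ι : Type*} [Fintype ι] (r : ι → ι → ℝ) (d : ι → ℝ)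
    (hrow : ∀ i, ∑ j, r i j = 0) (hcol : ∀ j, ∑ i, r i j = 0) :
    ∑ i, ∑ j, r i j ^ 2 ≤ ∑ i, ∑ j, (r i j - (d i - d j)) ^ 2 := by
  have cross_row : ∑ i, ∑ j, d i * r i j = 0 := by
    simp [← Finset.mul_sum, hrow]
  have cross_col : ∑ i, ∑ j, d j * r i j = 0 := by
    rw [Finset.sum_comm]
    simp [← Finset.mul_sum, hcol]
  have expand : ∑ i, ∑ j, (r i j - (d i - d j)) ^ 2 =
      ∑ i, ∑ j, r i j ^ 2 - 2 * ∑ i, ∑ j, d i * r i j + 2 * ∑ i, ∑ j, d j * r i j +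
        ∑ i, ∑ j, (d i - d j) ^ 2 := by
    simp only [Finset.mul_sum, ← Finset.sum_sub_distrib, ← Finset.sum_add_distrib]
    exact Finset.sum_congr rfl fun i _ => Finset.sum_congr rfl fun j _ => by ring
  have nonneg : 0 ≤ ∑ i, ∑ j, (d i - d j) ^ 2 := by positivity
  rw [expand, cross_row, cross_col]
  linarith

/-- The row means of an antisymmetric matrix give its best least squares approximation by a
difference matrix `x i - x j`. -/
theorem sum_sub_rowMean_diff_sq_le {ι : Type*} [Fintype ι] (L : ι → ι → ℝ) (g x : ι → ℝ)
    (hL : ∀ i j, L j i = -L i j) (hg : ∀ i, Fintype.card ι * g i = ∑ j, L i j) :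
    ∑ i, ∑ j, (L i j - (g i - g j)) ^ 2 ≤ ∑ i, ∑ j, (L i j - (x i - x j)) ^ 2 := by
  have total : ∑ i, ∑ j, L i j = 0 := by
    have h : ∑ i, ∑ j, L i j = -∑ i, ∑ j, L i j := by
      conv_lhs => rw [Finset.sum_comm]
      simp only [← Finset.sum_neg_distrib, ← hL]
    linarith
  have mean_sum : ∑ i, g i = 0 := by
    rcases isEmpty_or_nonempty ι with _ | _
    · simp
    · have h : (Fintype.card ι : ℝ) * ∑ i, g i = 0 := by
        rw [Finset.mul_sum, ← total]
        exact Finset.sum_congr rfl fun i _ => hg i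
      exact (mul_eq_zero.mp h).resolve_left (by simp)
  have row : ∀ i, ∑ j, (L i j - (g i - g j)) = 0 := fun i => by
    simp [Finset.sum_sub_distrib, mean_sum, ← hg]
  have col : ∀ j, ∑ i, (L i j - (g i - g j)) = 0 := fun j => by
    rw [← neg_eq_zero, ← Finset.sum_neg_distrib, ← row j]
    exact Finset.sum_congr rfl fun i _ => by rw [hL i j]; ring
  refine (sum_sq_le_sum_sub_diff_sq _ (fun i => x i - g i) row col).trans_eq ?_
  exact Finset.sum_congr rfl fun i _ => Finset.sum_congr rfl fun j _ => by ring

/-- Let `A` be an `n × n` pairwise comparison matrix and let `wGM` be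
its geometric mean priority vector. Then `wGM` minimizes the logarithmic least squares
objective: for every vector `w` with strictly positive entries summing to `1`,
`∑ i ∑ j (ln (A i j) - ln (wGM i / wGM j))² ≤ ∑ i ∑ j (ln (A i j) - ln (w i / w j))²`. -/
theorem stmt_14 (n : ℕ) (A : Matrix (Fin n) (Fin n) ℝ)
    (hpos : ∀ i j, 0 < A i j)
    (hrec : ∀ i j, A j i = 1 / A i j)
    (wGM : Fin n → ℝ)
    (hGM : ∀ i, wGM i =
      (∏ k, A i k) ^ ((n : ℝ)⁻¹) / ∑ j, (∏ k, A j k) ^ ((n : ℝ)⁻¹)) :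
    ∀ w : Fin n → ℝ, (∀ i, 0 < w i) → ∑ i, w i = 1 →
      ∑ i, ∑ j, (Real.log (A i j) - Real.log (wGM i / wGM j)) ^ 2 ≤
        ∑ i, ∑ j, (Real.log (A i j) - Real.log (w i / w j)) ^ 2 := by
  intro w hw _
  have prod_pos : ∀ i, 0 < ∏ k, A i k := fun i => Finset.prod_pos fun k _ => hpos i k
  have log_ratio : ∀ i j, Real.log (wGM i / wGM j) =
      (n : ℝ)⁻¹ * ∑ k, Real.log (A i k) - (n : ℝ)⁻¹ * ∑ k, Real.log (A j k) := fun i j => by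
    have root_pos : ∀ l, 0 < (∏ k, A l k) ^ ((n : ℝ)⁻¹) := fun l =>
      Real.rpow_pos_of_pos (prod_pos l) _
    have norm_pos : 0 < ∑ l, (∏ k, A l k) ^ ((n : ℝ)⁻¹) :=
      Finset.sum_pos (fun l _ => root_pos l) ⟨i, Finset.mem_univ i⟩
    rw [hGM i, hGM j, div_div_div_cancel_right₀ norm_pos.ne',
      Real.log_div (root_pos i).ne' (root_pos j).ne', Real.log_rpow (prod_pos i),
      Real.log_rpow (prod_pos j), Real.log_prod fun k _ => (hpos i k).ne',
      Real.log_prod fun k _ => (hpos j k).ne']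
  simp only [log_ratio, fun i j => Real.log_div (hw i).ne' (hw j).ne']
  refine sum_sub_rowMean_diff_sq_le (fun i j => Real.log (A i j))
    (fun i => (n : ℝ)⁻¹ * ∑ k, Real.log (A i k)) (fun i => Real.log (w i))
    (fun i j => by simp [hrec i j]) fun i => ?_
  have card_ne : (n : ℝ) ≠ 0 := Nat.cast_ne_zero.mpr i.pos.ne'
  rw [Fintype.card_fin, mul_inv_cancel_left₀ card_ne]
end
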